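/- Let p ≥ 1 and K ∈ C²(ℝ^p × ℝ^p) satisfy |∇_{x₁}K(x₁,y₂)| ≤ C/(1+|x₁−y₂|²) for all x₁, y₂ ∈ ℝ^p and some constant C > 0. Then there exists a constant C'' > 0, depending only on C, such that for every probability measure μ on ℝ^p × ℝ^p with finite first moment and every x ∈ ℝ^p: |∫ ∇_{x₁}K(x, y₂) μ(dy₁ dy₂)| ≤ C/(1+|x|) + C·P_μ(|Y₂| ≥ |x| − √|x|) ≤ C''·(1 + ∫|y| μ(dy))/(1+|x|), where Y₂ denotes the second marginal coordinate under μ. -/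

import Mathlib

noncomputable section

open MeasureTheory

abbrev E (p : ℕ) := EuclideanSpace ℝ (Fin p)

/-- A function bounded by `C / (1 + ‖x - y‖ ^ 2)` is of size `C / (1 + ‖x‖)` unless `‖y‖` is at
least `‖x‖ - √‖x‖`. -/
theorem div_one_add_norm_sub_sq_le {F : Type*} [SeminormedAddCommGroup F] {C : ℝ} (hC : 0 ≤ C)
    {x y : F} (h : ‖y‖ < ‖x‖ - √‖x‖) :
    C / (1 + ‖x - y‖ ^ 2) ≤ C / (1 + ‖x‖) := by
  have hsub : √‖x‖ ≤ ‖x - y‖ := by linarith [norm_sub_norm_le x y]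
  have hsq : ‖x‖ ≤ ‖x - y‖ ^ 2 := by
    calc ‖x‖ = √‖x‖ ^ 2 := (Real.sq_sqrt (norm_nonneg x)).symm
      _ ≤ ‖x - y‖ ^ 2 := by gcongr
  gcongr

theorem norm_integral_le_add_measure {Ω F G : Type*} [MeasurableSpace Ω]
    [NormedAddCommGroup F] [MeasurableSpace F] [OpensMeasurableSpace F]
    [NormedAddCommGroup G] [NormedSpace ℝ G] {C : ℝ} (hC : 0 ≤ C)
    {μ : Measure Ω} [IsProbabilityMeasure μ] {Y : Ω → F} (hY : Measurable Y) (x : F) {g : Ω → G}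
    (hg : ∀ ω, ‖g ω‖ ≤ C / (1 + ‖x - Y ω‖ ^ 2)) :
    ‖∫ ω, g ω ∂μ‖ ≤ C / (1 + ‖x‖) + C * μ.real {ω | ‖x‖ - √‖x‖ ≤ ‖Y ω‖} := by
  set S : Set Ω := {ω | ‖x‖ - √‖x‖ ≤ ‖Y ω‖}
  have hS : MeasurableSet S := measurableSet_le measurable_const hY.norm
  have hint : Integrable (S.indicator fun _ => C) μ := (integrable_const C).indicator hS
  calc ‖∫ ω, g ω ∂μ‖ ≤ ∫ ω, (C / (1 + ‖x‖) + S.indicator (fun _ => C) ω) ∂μ := by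
        refine norm_integral_le_of_norm_le ((integrable_const _).add hint) (.of_forall fun ω => ?_)
        refine (hg ω).trans ?_
        by_cases hω : ω ∈ S
        · have h1 : C / (1 + ‖x - Y ω‖ ^ 2) ≤ C :=
            div_le_self hC (le_add_of_nonneg_right (sq_nonneg _))
          have h2 : 0 ≤ C / (1 + ‖x‖) := by positivity
          rw [Set.indicator_of_mem hω]
          linarith
        · rw [Set.indicator_of_notMem hω, add_zero]
          exact div_one_add_norm_sub_sq_le hC (not_le.mp hω)
    _ = C / (1 + ‖x‖) + C * μ.real S := by
        rw [integral_add (integrable_const _) hint, integral_indicator_const _ hS]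
        simp [mul_comm]

/-- Markov's inequality at level `t - √t`. -/
theorem measureReal_sub_sqrt_le {Ω : Type*} [MeasurableSpace Ω] {μ : Measure Ω}
    [IsProbabilityMeasure μ] {f g : Ω → ℝ} (hf : Integrable f μ) (hf0 : 0 ≤ f) (hgf : g ≤ f)
    {t : ℝ} (ht : 0 ≤ t) :
    μ.real {ω | t - √t ≤ g ω} ≤ 5 * (1 + ∫ ω, f ω ∂μ) / (1 + t) := by
  have hm : 0 ≤ ∫ ω, f ω ∂μ := integral_nonneg hf0
  rw [le_div_iff₀ (by positivity)]
  have hP1 : μ.real {ω | t - √t ≤ g ω} ≤ 1 := measureReal_le_one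
  have hP0 : 0 ≤ μ.real {ω | t - √t ≤ g ω} := measureReal_nonneg
  rcases le_total t 4 with h | h
  · nlinarith
  · have hhalf : t / 2 ≤ t - √t := by
      have h2 : 2 ≤ √t := Real.le_sqrt_of_sq_le (by linarith)
      nlinarith [Real.sq_sqrt ht]
    have hsub : μ.real {ω | t - √t ≤ g ω} ≤ μ.real {ω | t / 2 ≤ f ω} :=
      measureReal_mono fun ω hω => hhalf.trans (le_trans hω (hgf ω))
    have hmarkov := mul_meas_ge_le_integral_of_nonneg (.of_forall hf0) hf (t / 2)
    nlinarith

/-- Decay of the competition-model interaction drift: if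
`|∇_{x₁} K(x₁,y₂)| ≤ C/(1+|x₁−y₂|²)`, then for every probability measure `μ` on
`ℝ^p × ℝ^p` with finite first moment and every `x`,
`|∫ ∇_{x₁}K(x,y₂) μ(dy)| ≤ C/(1+|x|) + C ⋅ P_μ(|Y₂| ≥ |x| − √|x|)`,
and this is bounded by `C'' (1 + ∫ |y| μ(dy))/(1+|x|)` for a constant `C''`
depending only on `C`. -/
theorem competition_drift_decay (C : ℝ) (hC : 0 < C) :
    ∃ C'' : ℝ, 0 < C'' ∧
      ∀ (p : ℕ), 1 ≤ p → ∀ K : E p × E p → ℝ, ContDiff ℝ 2 K →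
        (∀ x y : E p, ‖gradient (fun a => K (a, y)) x‖ ≤ C / (1 + ‖x - y‖ ^ 2)) →
        ∀ μ : Measure (E p × E p), IsProbabilityMeasure μ →
          Integrable (fun y : E p × E p => Real.sqrt (‖y.1‖ ^ 2 + ‖y.2‖ ^ 2)) μ →
          ∀ x : E p,
            ‖∫ y, gradient (fun a => K (a, y.2)) x ∂μ‖
                ≤ C / (1 + ‖x‖)
                  + C * (μ {y : E p × E p | ‖x‖ - Real.sqrt ‖x‖ ≤ ‖y.2‖}).toReal
            ∧ ‖∫ y, gradient (fun a => K (a, y.2)) x ∂μ‖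
                ≤ C'' * (1 + ∫ y, Real.sqrt (‖y.1‖ ^ 2 + ‖y.2‖ ^ 2) ∂μ) / (1 + ‖x‖) := by
  refine ⟨6 * C, by positivity, fun p _ K _ hK μ _ hint x => ?_⟩
  have hdrift := norm_integral_le_add_measure (μ := μ) hC.le measurable_snd x fun y => hK x y.2
  refine ⟨hdrift, hdrift.trans ?_⟩
  have htail := measureReal_sub_sqrt_le (g := fun y : E p × E p => ‖y.2‖) hint
    (fun y => Real.sqrt_nonneg _)
    (fun y => Real.le_sqrt_of_sq_le (le_add_of_nonneg_left (sq_nonneg _))) (norm_nonneg x)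
  have hm : 0 ≤ ∫ y, √(‖y.1‖ ^ 2 + ‖y.2‖ ^ 2) ∂μ := integral_nonneg fun y => Real.sqrt_nonneg _
  set m := ∫ y, √(‖y.1‖ ^ 2 + ‖y.2‖ ^ 2) ∂μ
  calc _ ≤ C * (1 + m) / (1 + ‖x‖) + C * (5 * (1 + m) / (1 + ‖x‖)) := by
        gcongr
        exact le_mul_of_one_le_right hC.le (by linarith)
    _ = 6 * C * (1 + m) / (1 + ‖x‖) := by ring
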